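/- For odd k with k ≥ 3, n ≥ (k−1)/2, and s ≠ t with s,t ≥ 1, the maximum number of copies of K_{s,t} in a bipartite graph with both parts of size n containing no linear forest with k edges equals C((k−1)/2, s)·C(n, t) + C((k−1)/2, t)·C(n, s). -/

import Mathlib

open SimpleGraph Finset

/-- `G` contains a linear forest with `k` edges: a subgraph that is acyclic
with maximum degree at most 2 and exactly `k` edges. -/
def containsLinearForest {V : Type*} (G : SimpleGraph V) (k : ℕ) : Prop :=
  ∃ H : SimpleGraph V, H ≤ G ∧ H.IsAcyclic ∧ (∀ v, (H.neighborSet v).ncard ≤ 2) ∧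
    H.edgeSet.ncard = k

/-- `G` contains a matching with `k` edges. -/
def containsMatching {V : Type*} (G : SimpleGraph V) (k : ℕ) : Prop :=
  ∃ H : SimpleGraph V, H ≤ G ∧ (∀ v, (H.neighborSet v).ncard ≤ 1) ∧ H.edgeSet.ncard = k

/-- Number of `s`-cliques (copies of `K_s`) in `G`. -/
noncomputable def cliqueCount {V : Type*} (G : SimpleGraph V) (s : ℕ) : ℕ :=
  {S : Finset V | G.IsNClique s S}.ncard

/-- Number of copies of `K*_{s,t}` in `G`: pairs `(W₁, W₂)` of disjoint vertex sets with
`|W₁| = s`, `|W₂| = t`, `W₁` a clique and all `W₁`–`W₂` edges present. -/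
noncomputable def kstCount {V : Type*} (G : SimpleGraph V) (s t : ℕ) : ℕ :=
  {p : Finset V × Finset V | p.1.card = s ∧ p.2.card = t ∧ Disjoint p.1 p.2 ∧
    G.IsClique (p.1 : Set V) ∧ ∀ a ∈ p.1, ∀ b ∈ p.2, G.Adj a b}.ncard

/-- A graph on `Fin n ⊕ Fin n` is bipartite with the two summands as parts. -/
def IsBip {n : ℕ} (G : SimpleGraph (Fin n ⊕ Fin n)) : Prop :=
  ∀ a b : Fin n, ¬ G.Adj (Sum.inl a) (Sum.inl b) ∧ ¬ G.Adj (Sum.inr a) (Sum.inr b)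

/-- Number of copies of `K_{s,t}` in a bipartite graph on parts `X = Fin n` (left) and
`Y = Fin n` (right): pairs `(S, T)` with `S ⊆ X`, `T ⊆ Y`, all `S`–`T` edges present, and
`(|S|, |T|) = (s, t)` or `(t, s)` (both orientations are counted). -/
noncomputable def bipKstCount {n : ℕ} (G : SimpleGraph (Fin n ⊕ Fin n)) (s t : ℕ) : ℕ :=
  {p : Finset (Fin n) × Finset (Fin n) |
    ((p.1.card = s ∧ p.2.card = t) ∨ (p.1.card = t ∧ p.2.card = s)) ∧
    ∀ a ∈ p.1, ∀ b ∈ p.2, G.Adj (Sum.inl a) (Sum.inr b)}.ncard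

theorem ncard_neighborSet_sup_edge_le {V : Type*} [Finite V] (H : SimpleGraph V) (u v w : V) :
    ((H ⊔ edge u v).neighborSet w).ncard ≤ (H.neighborSet w).ncard + 1 := by
  classical
  have h : (H ⊔ edge u v).neighborSet w ⊆
      insert (if w = u then v else u) (H.neighborSet w) := by
    intro z hz
    simp only [mem_neighborSet, sup_adj, edge_adj, Set.mem_insert_iff] at hz ⊢
    grind
  exact (Set.ncard_le_ncard h (Set.toFinite _)).trans (Set.ncard_insert_le _ _)

theorem neighborSet_sup_edge_of_ne {V : Type*} (H : SimpleGraph V) {u v w : V}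
    (hu : w ≠ u) (hv : w ≠ v) : (H ⊔ edge u v).neighborSet w = H.neighborSet w := by
  ext z
  simp only [mem_neighborSet, sup_adj, edge_adj]
  grind

/-- Joining two vertices of degree at most one in different components of a linear forest gives a
linear forest with one more edge. -/
theorem linearForest_sup_edge {V : Type*} [Finite V] {H : SimpleGraph V} (hac : H.IsAcyclic)
    (hdeg : ∀ w, (H.neighborSet w).ncard ≤ 2) {u v : V} (huv : ¬ H.Reachable u v)
    (hu : (H.neighborSet u).ncard ≤ 1) (hv : (H.neighborSet v).ncard ≤ 1) :
    (H ⊔ edge u v).IsAcyclic ∧ (∀ w, ((H ⊔ edge u v).neighborSet w).ncard ≤ 2) ∧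
      (H ⊔ edge u v).edgeSet.ncard = H.edgeSet.ncard + 1 := by
  have hne : u ≠ v := fun h => huv (h ▸ Reachable.refl _)
  refine ⟨hac.sup_edge_of_not_reachable huv, fun w => ?_, ?_⟩
  · have := ncard_neighborSet_sup_edge_le H u v w
    by_cases h1 : w = u
    · subst h1; omega
    by_cases h2 : w = v
    · subst h2; omega
    rw [neighborSet_sup_edge_of_ne H h1 h2]
    exact hdeg w
  · have h : (H ⊔ edge u v).edgeSet = insert s(u, v) H.edgeSet := by
      ext e
      induction e with | _ x y =>
      simp only [mem_edgeSet, sup_adj, edge_adj, Set.mem_insert_iff, Sym2.eq_iff]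
      grind
    rw [h, Set.ncard_insert_of_notMem _ (Set.toFinite _)]
    exact fun h => huv (Adj.reachable h)

theorem ncard_neighborSet_eq_degree {V : Type*} (H : SimpleGraph V) (v : V)
    [Fintype (H.neighborSet v)] : (H.neighborSet v).ncard = H.degree v :=
  Set.ncard_eq_toFinset_card' _

/-- A component of a graph of maximum degree at most two has at most two vertices of degree at
most one. -/
theorem not_three_reachable_of_ncard_neighborSet_le {V : Type*} [Finite V] {H : SimpleGraph V}
    (hdeg : ∀ w, (H.neighborSet w).ncard ≤ 2) {a b c : V} (hab : a ≠ b) (hac : a ≠ c)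
    (hbc : b ≠ c) (ha : (H.neighborSet a).ncard ≤ 1) (hb : (H.neighborSet b).ncard ≤ 1)
    (hc : (H.neighborSet c).ncard ≤ 1) (rab : H.Reachable a b) (rac : H.Reachable a c) :
    False := by
  classical
  have := Fintype.ofFinite V
  set C := H.connectedComponentMk a
  have ma : a ∈ C := rfl
  have mb : b ∈ C := ConnectedComponent.sound rab.symm
  have mc : c ∈ C := ConnectedComponent.sound rac.symm
  have h1 := C.connected_toSimpleGraph.card_vert_le_card_edgeSet_add_one
  have h2 := C.toSimpleGraph.sum_degrees_eq_twice_card_edges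
  have hd : ∀ w : C, C.toSimpleGraph.degree w ≤ (H.neighborSet w.1).ncard := by
    intro w
    rw [← ncard_neighborSet_eq_degree]
    refine Set.ncard_le_ncard_of_injOn Subtype.val ?_ Subtype.val_injective.injOn
    intro z hz
    exact hz
  have h3 : ∑ w : C, (C.toSimpleGraph.degree w +
      if w ∈ ({⟨a, ma⟩, ⟨b, mb⟩, ⟨c, mc⟩} : Finset C) then 1 else 0) ≤ ∑ w : C, 2 := by
    refine sum_le_sum fun w _ => ?_
    have := hd w
    have := hdeg w
    split_ifs with hw
    · simp only [mem_insert, mem_singleton] at hw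
      have : (H.neighborSet w.1).ncard ≤ 1 := by rcases hw with rfl | rfl | rfl <;> assumption
      omega
    · omega
  rw [sum_add_distrib, sum_boole, filter_mem_eq_inter, univ_inter,
    card_eq_three.2 ⟨_, _, _, by simpa using hab, by simpa using hac, by simpa using hbc, rfl⟩,
    sum_const, h2, card_univ, Nat.cast_ofNat, smul_eq_mul, ← Nat.card_eq_fintype_card] at h3
  rw [Nat.card_eq_fintype_card (α := C.toSimpleGraph.edgeSet), ← edgeFinset_card] at h1
  omega

theorem IsBip.isBipartiteWith {n : ℕ} {G : SimpleGraph (Fin n ⊕ Fin n)} (hG : IsBip G) :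
    G.IsBipartiteWith ((univ.map Function.Embedding.inl : Finset (Fin n ⊕ Fin n)) : Set _)
      ((univ.map Function.Embedding.inr : Finset (Fin n ⊕ Fin n)) : Set _) where
  disjoint := by
    rw [Set.disjoint_left]
    simp
  mem_of_adj := by
    rintro (v | v) (w | w) h
    · exact absurd h (hG v w).1
    · simp
    · simp
    · exact absurd h (hG v w).2

theorem IsBip.sum_ncard_neighborSet_inl {n : ℕ} {G : SimpleGraph (Fin n ⊕ Fin n)}
    (hG : IsBip G) : ∑ x, (G.neighborSet (Sum.inl x)).ncard = G.edgeSet.ncard := by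
  classical
  have h := isBipartiteWith_sum_degrees_eq_card_edges hG.isBipartiteWith
  rw [sum_map] at h
  simp only [← ncard_neighborSet_eq_degree] at h
  rw [Set.ncard_eq_toFinset_card' G.edgeSet]
  exact h

theorem IsBip.sum_ncard_neighborSet_inr {n : ℕ} {G : SimpleGraph (Fin n ⊕ Fin n)}
    (hG : IsBip G) : ∑ y, (G.neighborSet (Sum.inr y)).ncard = G.edgeSet.ncard := by
  classical
  have h := isBipartiteWith_sum_degrees_eq_card_edges' hG.isBipartiteWith
  rw [sum_map] at h
  simp only [← ncard_neighborSet_eq_degree] at h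
  rw [Set.ncard_eq_toFinset_card' G.edgeSet]
  exact h

theorem IsBip.anti {n : ℕ} {G H : SimpleGraph (Fin n ⊕ Fin n)} (hG : IsBip G) (h : H ≤ G) :
    IsBip H :=
  fun a b => ⟨fun e => (hG a b).1 (h e), fun e => (hG a b).2 (h e)⟩

theorem one_le_ncard_neighborSet_of_reachable {V : Type*} [Finite V] {H : SimpleGraph V}
    {a b : V} (h : H.Reachable a b) (hab : a ≠ b) : 1 ≤ (H.neighborSet a).ncard := by
  obtain ⟨p⟩ := h
  cases p with
  | nil => exact absurd rfl hab
  | cons e _ => exact (Set.ncard_pos (Set.toFinite _)).2 ⟨_, e⟩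

/-- In a bipartite linear forest with `2 * r - 1` edges, any `r + 1` vertices on the right include
two of degree at most one in different components. -/
theorem IsBip.exists_not_reachable {n r : ℕ} {H : SimpleGraph (Fin n ⊕ Fin n)} (hH : IsBip H)
    (hdeg : ∀ w, (H.neighborSet w).ncard ≤ 2) (hr : H.edgeSet.ncard + 1 = 2 * r)
    (N : Finset (Fin n)) (hN : r + 1 ≤ #N) :
    ∃ y ∈ N, ∃ z ∈ N, (H.neighborSet (Sum.inr y)).ncard ≤ 1 ∧
      (H.neighborSet (Sum.inr z)).ncard ≤ 1 ∧ ¬ H.Reachable (Sum.inr y) (Sum.inr z) := by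
  by_contra! hcon
  set d : Fin n → ℕ := fun y => (H.neighborSet (Sum.inr y)).ncard with hd
  have hsum : ∑ y ∈ N, d y + 1 ≤ 2 * r := by
    rw [← hr, ← hH.sum_ncard_neighborSet_inr]
    gcongr
    exact subset_univ _
  set L := N.filter (fun y => d y ≤ 1) with hL
  have hmem : ∀ y ∈ L, y ∈ N ∧ d y ≤ 1 := fun y hy => by simpa [hL] using hy
  have hsplit : ∑ y ∈ L, d y + ∑ y ∈ N with ¬ d y ≤ 1, d y = ∑ y ∈ N, d y :=
    sum_filter_add_sum_filter_not _ _ _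
  have hcard : #L + #{y ∈ N | ¬ d y ≤ 1} = #N := card_filter_add_card_filter_not _
  have hfull : #{y ∈ N | ¬ d y ≤ 1} * 2 ≤ ∑ y ∈ N with ¬ d y ≤ 1, d y := by
    rw [← smul_eq_mul]
    refine card_nsmul_le_sum _ _ _ fun y hy => ?_
    have := (mem_filter.1 hy).2
    omega
  have hL2 : #L ≤ 2 := by
    by_contra! h
    obtain ⟨a, b, c, ha, hb, hc, hab, hac, hbc⟩ := two_lt_card_iff.1 h
    obtain ⟨ha, ha'⟩ := hmem a ha
    obtain ⟨hb, hb'⟩ := hmem b hb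
    obtain ⟨hc, hc'⟩ := hmem c hc
    exact not_three_reachable_of_ncard_neighborSet_le hdeg (Sum.inr_injective.ne hab)
      (Sum.inr_injective.ne hac) (Sum.inr_injective.ne hbc) ha' hb' hc'
      (hcon a ha b hb ha' hb') (hcon a ha c hc ha' hc')
  rcases Nat.lt_or_ge #L 2 with h | h
  · omega
  · obtain ⟨a, b, hab, hLab⟩ := card_eq_two.1 (le_antisymm hL2 h)
    obtain ⟨ha, ha'⟩ := hmem a (by simp [hLab])
    obtain ⟨hb, hb'⟩ := hmem b (by simp [hLab])
    have h1 := one_le_ncard_neighborSet_of_reachable (hcon a ha b hb ha' hb')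
      (Sum.inr_injective.ne hab)
    have h2 := one_le_ncard_neighborSet_of_reachable (hcon b hb a ha hb' ha')
      (Sum.inr_injective.ne hab.symm)
    have h3 : ∑ y ∈ L, d y = d a + d b := by rw [hLab, sum_pair hab]
    simp only [hd] at *
    omega

/-- Attaching an isolated vertex to two vertices of degree at most one in different components of a
linear forest gives a linear forest with two more edges. -/
theorem linearForest_sup_edge_sup_edge {V : Type*} [Finite V] {H : SimpleGraph V}
    (hac : H.IsAcyclic) (hdeg : ∀ w, (H.neighborSet w).ncard ≤ 2) {v y z : V}
    (hv : ∀ w, ¬ H.Adj v w) (hvy : v ≠ y) (hvz : v ≠ z)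
    (hy : (H.neighborSet y).ncard ≤ 1) (hz : (H.neighborSet z).ncard ≤ 1)
    (hyz : ¬ H.Reachable y z) :
    (H ⊔ edge v y ⊔ edge v z).IsAcyclic ∧
      (∀ w, ((H ⊔ edge v y ⊔ edge v z).neighborSet w).ncard ≤ 2) ∧
      (H ⊔ edge v y ⊔ edge v z).edgeSet.ncard = H.edgeSet.ncard + 2 := by
  have hv0 : (H.neighborSet v).ncard = 0 := by
    rw [Set.ncard_eq_zero (Set.toFinite _)]
    ext w
    simp [hv w]
  have hnr : ∀ w, v ≠ w → ¬ H.Reachable v w := fun w hw h => by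
    have := one_le_ncard_neighborSet_of_reachable h hw
    omega
  obtain ⟨h1, h2, h3⟩ := linearForest_sup_edge hac hdeg (hnr y hvy) (by omega) hy
  have hne : y ≠ z := fun h => hyz (h ▸ Reachable.refl _)
  have hclosed : ∀ a b, (H ⊔ edge v y).Reachable a b → (a = v ∨ H.Reachable y a) →
      (b = v ∨ H.Reachable y b) := by
    rintro a b ⟨p⟩
    induction p with
    | nil => exact id
    | cons e _ ih =>
      intro ha
      apply ih
      rw [sup_adj, edge_adj] at e
      rcases e with e | ⟨⟨rfl, rfl⟩ | ⟨rfl, rfl⟩, -⟩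
      · rcases ha with rfl | ha
        · exact absurd e (hv _)
        · exact .inr (ha.trans e.reachable)
      · exact .inr (Reachable.refl _)
      · exact .inl rfl
  have hnr' : ¬ (H ⊔ edge v y).Reachable v z := fun h => by
    rcases hclosed v z h (.inl rfl) with h | h
    · exact hvz h.symm
    · exact hyz h
  have hv1 := ncard_neighborSet_sup_edge_le H v y v
  obtain ⟨h4, h5, h6⟩ := linearForest_sup_edge h1 h2 hnr' (by omega)
    (by rwa [neighborSet_sup_edge_of_ne H hvz.symm hne.symm])
  exact ⟨h4, h5, by omega⟩

/-- If for each `a ≤ m` more than `a` vertices on the left have degree exceeding `m - a`, then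
there are linear forests with `2 * r - 1` edges avoiding any `m + 1 - r` vertices on the left. -/
theorem IsBip.exists_linearForest_avoiding {n m : ℕ} {G : SimpleGraph (Fin n ⊕ Fin n)}
    (hG : IsBip G)
    (hD : ∀ a ≤ m, a < #{x : Fin n | m - a < (G.neighborSet (Sum.inl x)).ncard}) (r : ℕ)
    (hr : 1 ≤ r) : ∀ A : Finset (Fin n), #A + r ≤ m + 1 →
    ∃ H ≤ G, H.IsAcyclic ∧ (∀ v, (H.neighborSet v).ncard ≤ 2) ∧ H.edgeSet.ncard + 1 = 2 * r ∧
      ∀ x ∈ A, ∀ w, ¬ H.Adj (Sum.inl x) w := by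
  classical
  induction r, hr using Nat.le_induction with
  | base =>
    intro A hA
    obtain ⟨v, hv, hvA⟩ := exists_mem_notMem_of_card_lt_card
      (lt_of_le_of_lt (by omega : #A ≤ m) (hD m le_rfl))
    rw [mem_filter, Nat.sub_self, Set.ncard_pos (Set.toFinite _)] at hv
    obtain ⟨-, y, hy⟩ := hv
    have hy : G.Adj (Sum.inl v) y := hy
    obtain ⟨h1, h2, h3⟩ := linearForest_sup_edge (H := (⊥ : SimpleGraph (Fin n ⊕ Fin n)))
      (u := Sum.inl v) (v := y) isAcyclic_bot (by simp [neighborSet])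
      (by simpa using hy.ne) (by simp [neighborSet]) (by simp [neighborSet])
    rw [bot_sup_eq] at h1 h2 h3
    refine ⟨edge (Sum.inl v) y, ?_, h1, h2, by simpa using h3, ?_⟩
    · exact (edge_le_iff ..).2 (.inr hy)
    · intro x hx w hw
      rcases y with y | y
      · exact (hG v y).1 hy
      · rw [edge_adj] at hw
        rcases hw.1 with ⟨h, -⟩ | ⟨h, -⟩
        · exact hvA (Sum.inl_injective h ▸ hx)
        · cases h
  | succ r hr ih =>
    intro A hA
    obtain ⟨v, hv, hvA⟩ := exists_mem_notMem_of_card_lt_card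
      (lt_of_le_of_lt (by omega : #A ≤ m - r) (hD (m - r) (by omega)))
    rw [mem_filter] at hv
    obtain ⟨H, hHG, h1, h2, h3, h4⟩ := ih (insert v A) (by rw [card_insert_of_notMem hvA]; omega)
    have hN : r + 1 ≤ #{y : Fin n | G.Adj (Sum.inl v) (Sum.inr y)} := by
      have : G.neighborSet (Sum.inl v) =
          Sum.inr '' ({y : Fin n | G.Adj (Sum.inl v) (Sum.inr y)} : Finset (Fin n)) := by
        ext w
        rcases w with w | w
        · simpa using (hG v w).1
        · simp
      have hv := hv.2
      rw [this, Set.ncard_image_of_injective _ Sum.inr_injective, Set.ncard_coe_finset] at hv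
      omega
    obtain ⟨y, hy, z, hz, hy1, hz1, hyz⟩ := (hG.anti hHG).exists_not_reachable h2 h3 _ hN
    obtain ⟨h5, h6, h7⟩ := linearForest_sup_edge_sup_edge h1 h2 (v := Sum.inl v)
      (h4 v (mem_insert_self _ _)) (by simp) (by simp) hy1 hz1 hyz
    rw [mem_filter] at hy hz
    refine ⟨_, sup_le (sup_le hHG ?_) ?_, h5, h6, by omega, ?_⟩
    · exact (edge_le_iff ..).2 (.inr hy.2)
    · exact (edge_le_iff ..).2 (.inr hz.2)
    · intro x hx w hw
      have hxv : x ≠ v := fun h => hvA (h ▸ hx)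
      simp only [sup_adj, edge_adj, Sum.inl.injEq, reduceCtorEq, false_and, or_false, hxv] at hw
      exact h4 x (mem_insert_of_mem hx) w hw

/-- A bipartite graph without a linear forest on `2 * m + 1` edges has, for some `a + b = m`, at
most `a` vertices of degree exceeding `b` on the left. -/
theorem IsBip.exists_card_degree_gt_le {n m : ℕ} {G : SimpleGraph (Fin n ⊕ Fin n)}
    (hG : IsBip G) (hfree : ¬ containsLinearForest G (2 * m + 1)) :
    ∃ a b, a + b = m ∧ #{x : Fin n | b < (G.neighborSet (Sum.inl x)).ncard} ≤ a := by
  by_contra! hcon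
  obtain ⟨H, h1, h2, h3, h4, -⟩ := hG.exists_linearForest_avoiding (m := m)
    (fun a ha => hcon a (m - a) (by omega)) (m + 1) (by omega) ∅ (by simp)
  exact hfree ⟨H, h1, h2, h3, by omega⟩

theorem choose_add_choose_le {s : ℕ} (hs : 1 ≤ s) (a b : ℕ) :
    a.choose s + b.choose s ≤ (a + b).choose s := by
  rw [Nat.add_choose_eq]
  have h : ({(s, 0), (0, s)} : Finset (ℕ × ℕ)) ⊆ antidiagonal s := by
    intro p
    simp only [mem_insert, mem_singleton, HasAntidiagonal.mem_antidiagonal]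
    rintro (rfl | rfl) <;> simp
  refine le_trans ?_ (sum_le_sum_of_subset h)
  rw [sum_pair (by simp; omega)]
  simp

theorem ncard_biclique_le {n a b : ℕ} {G : SimpleGraph (Fin n ⊕ Fin n)}
    (h : #{x : Fin n | b < (G.neighborSet (Sum.inl x)).ncard} ≤ a) (s t : ℕ) :
    {p : Finset (Fin n) × Finset (Fin n) | (p.1.card = s ∧ p.2.card = t) ∧
      ∀ x ∈ p.1, ∀ y ∈ p.2, G.Adj (Sum.inl x) (Sum.inr y)}.ncard ≤
      a.choose s * n.choose t + n.choose s * b.choose t := by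
  classical
  set A : Finset (Fin n) := {x : Fin n | b < (G.neighborSet (Sum.inl x)).ncard} with hA
  set N : Finset (Fin n) → Finset (Fin n) := fun S =>
    {y | ∀ x ∈ S, G.Adj (Sum.inl x) (Sum.inr y)} with hN
  set U : Finset (Σ _ : Finset (Fin n), Finset (Fin n)) :=
    ((powersetCard s univ).filter (fun S => ¬ S ⊆ A)).sigma (fun S => powersetCard t (N S))
  have hU : #U ≤ n.choose s * b.choose t := by
    rw [card_sigma]
    have hc : #((powersetCard s (univ : Finset (Fin n))).filter (fun S => ¬ S ⊆ A)) ≤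
        n.choose s := (card_filter_le _ _).trans (by simp)
    refine le_trans (sum_le_card_nsmul _ _ (b.choose t) fun S hS => ?_)
      (Nat.mul_le_mul_right _ hc)
    obtain ⟨x, hx, hxA⟩ := not_subset.1 (mem_filter.1 hS).2
    rw [card_powersetCard]
    refine Nat.choose_le_choose _ ?_
    have hxb : (G.neighborSet (Sum.inl x)).ncard ≤ b := by simpa [hA] using hxA
    refine le_trans ?_ hxb
    rw [← Set.ncard_coe_finset]
    refine Set.ncard_le_ncard_of_injOn Sum.inr ?_ Sum.inr_injective.injOn (Set.toFinite _)
    intro y hy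
    exact (mem_filter.1 hy).2 x hx
  have hsub : {p : Finset (Fin n) × Finset (Fin n) | (p.1.card = s ∧ p.2.card = t) ∧
      ∀ x ∈ p.1, ∀ y ∈ p.2, G.Adj (Sum.inl x) (Sum.inr y)} ⊆
      ((powersetCard s A ×ˢ powersetCard t univ ∪ U.image (fun q => (q.1, q.2)) :
        Finset (Finset (Fin n) × Finset (Fin n))) : Set _) := by
    rintro ⟨S, T⟩ ⟨⟨hS, hT⟩, hST⟩
    simp only [coe_union, Set.mem_union, mem_coe, mem_product, mem_powersetCard]
    by_cases hSA : S ⊆ A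
    · exact .inl ⟨⟨hSA, hS⟩, subset_univ _, hT⟩
    · refine .inr (mem_image.2 ⟨⟨S, T⟩, ?_, rfl⟩)
      simp only [U, mem_sigma, mem_filter, mem_powersetCard]
      exact ⟨⟨⟨subset_univ _, hS⟩, hSA⟩, fun y hy => by
        simpa [hN] using fun x hx => hST x hx y hy, hT⟩
  refine (Set.ncard_le_ncard hsub (Set.toFinite _)).trans ?_
  rw [Set.ncard_coe_finset]
  refine (card_union_le _ _).trans (add_le_add ?_ (card_image_le.trans hU))
  rw [card_product, card_powersetCard, card_powersetCard, card_univ, Fintype.card_fin]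
  exact Nat.mul_le_mul_right _ (Nat.choose_le_choose _ h)

theorem IsBip.bipKstCount_le {n m s t : ℕ} {G : SimpleGraph (Fin n ⊕ Fin n)} (hG : IsBip G)
    (hfree : ¬ containsLinearForest G (2 * m + 1)) (hs : 1 ≤ s) (ht : 1 ≤ t) :
    bipKstCount G s t ≤ m.choose s * n.choose t + m.choose t * n.choose s := by
  obtain ⟨a, b, rfl, h⟩ := hG.exists_card_degree_gt_le hfree
  unfold bipKstCount
  simp only [or_and_right, Set.ofPred_or]
  refine (Set.ncard_union_le _ _).trans ?_
  have h1 := ncard_biclique_le h s t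
  have h2 := ncard_biclique_le h t s
  have h3 := Nat.mul_le_mul_right (n.choose t) (choose_add_choose_le hs a b)
  have h4 := Nat.mul_le_mul_right (n.choose s) (choose_add_choose_le ht a b)
  nlinarith

/-- The bipartite graph joining the first `m` vertices on the left to all vertices on the right. -/
def leftComplete (n m : ℕ) : SimpleGraph (Fin n ⊕ Fin n) :=
  SimpleGraph.fromRel fun u v => ∃ x y : Fin n, x.1 < m ∧ u = Sum.inl x ∧ v = Sum.inr y

theorem leftComplete_adj {n m : ℕ} (x y : Fin n) :
    (leftComplete n m).Adj (Sum.inl x) (Sum.inr y) ↔ x.1 < m := by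
  simp [leftComplete]

theorem isBip_leftComplete (n m : ℕ) : IsBip (leftComplete n m) := by
  intro a b
  simp [leftComplete]

theorem card_fin_filter_lt {n m : ℕ} (h : m ≤ n) : #{x : Fin n | x.1 < m} = m := by
  have := Fin.card_filter_val_lt (n := n) (m := m)
  omega

theorem not_containsLinearForest_leftComplete {n m : ℕ} (h : m ≤ n) :
    ¬ containsLinearForest (leftComplete n m) (2 * m + 1) := by
  rintro ⟨H, hle, -, hdeg, hcard⟩
  have hb := isBip_leftComplete n m
  rw [← (hb.anti hle).sum_ncard_neighborSet_inl] at hcard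
  have : ∑ x : Fin n, (H.neighborSet (Sum.inl x)).ncard ≤
      ∑ x : Fin n, if x.1 < m then 2 else 0 := by
    refine sum_le_sum fun x _ => ?_
    split_ifs with hx
    · exact hdeg _
    · rw [Nat.le_zero, Set.ncard_eq_zero (Set.toFinite _), Set.eq_empty_iff_forall_notMem]
      rintro (w | w) hw
      · exact (hb x w).1 (hle hw)
      · exact hx ((leftComplete_adj x w).1 (hle hw))
  rw [← sum_filter, sum_const, card_fin_filter_lt h, smul_eq_mul] at this
  omega

theorem le_bipKstCount_leftComplete {n m s t : ℕ} (h : m ≤ n) (hst : s ≠ t) :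
    m.choose s * n.choose t + m.choose t * n.choose s ≤ bipKstCount (leftComplete n m) s t := by
  classical
  set A : Finset (Fin n) := {x : Fin n | x.1 < m} with hA
  have hcard : ∀ s t, #(powersetCard s A ×ˢ powersetCard t (univ : Finset (Fin n))) =
      m.choose s * n.choose t := fun s t => by
    rw [card_product, card_powersetCard, card_powersetCard, card_univ, Fintype.card_fin, hA,
      card_fin_filter_lt h]
  rw [← hcard, ← hcard, ← card_union_of_disjoint, ← Set.ncard_coe_finset]
  · refine Set.ncard_le_ncard ?_ (Set.toFinite _)
    rintro ⟨S, T⟩ hp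
    simp only [coe_union, Set.mem_union, mem_coe, mem_product, mem_powersetCard, subset_univ,
      true_and] at hp
    refine ⟨hp.imp (fun h => ⟨h.1.2, h.2⟩) (fun h => ⟨h.1.2, h.2⟩), fun x hx y _ => ?_⟩
    rw [leftComplete_adj]
    have hSA : S ⊆ A := hp.elim (fun h => h.1.1) (fun h => h.1.1)
    simpa [hA] using hSA hx
  · rw [Finset.disjoint_left]
    rintro ⟨S, T⟩ h1 h2
    simp only [mem_product, mem_powersetCard] at h1 h2
    exact hst (h1.1.2.symm.trans h2.1.2)

/-- For odd `k ≥ 3`, `n ≥ (k-1)/2` and `s ≠ t` (`s,t ≥ 1`), the maximum number of copies of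
`K_{s,t}` in a bipartite graph with parts of size `n` and no linear forest with `k` edges is
`C((k-1)/2, s)·C(n, t) + C((k-1)/2, t)·C(n, s)`. -/
theorem stmt13 (n k s t : ℕ) (hk : Odd k) (hk3 : 3 ≤ k) (hn : (k - 1) / 2 ≤ n)
    (hs : 1 ≤ s) (ht : 1 ≤ t) (hst : s ≠ t) :
    IsGreatest {c | ∃ G : SimpleGraph (Fin n ⊕ Fin n), IsBip G ∧
        ¬ containsLinearForest G k ∧ c = bipKstCount G s t}
      (Nat.choose ((k - 1) / 2) s * Nat.choose n t +
        Nat.choose ((k - 1) / 2) t * Nat.choose n s) := by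
  obtain ⟨m, rfl⟩ := hk
  have hm : (2 * m + 1 - 1) / 2 = m := by omega
  rw [hm] at hn ⊢
  refine ⟨⟨leftComplete n m, isBip_leftComplete n m, not_containsLinearForest_leftComplete hn,
    le_antisymm (le_bipKstCount_leftComplete hn hst) ?_⟩, ?_⟩
  · exact (isBip_leftComplete n m).bipKstCount_le (not_containsLinearForest_leftComplete hn) hs ht
  · rintro c ⟨G, hG, hfree, rfl⟩
    exact hG.bipKstCount_le hfree hs ht
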